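/- arXiv:1607.05504 — 6 statements merged into one kernel-verified Lean document; each statement's English description precedes it below -/
import Mathlib

section
/- For every t > 0 and every ξ ∈ ℝ, ∫_ℝ (1/π) · (t/(x² + t²)) · e^{−ixξ} dx = e^{−t|ξ|}. -/
open MeasureTheory Real

open scoped FourierTransform

theorem integrable_cexp_neg_mul_abs {t : ℝ} (ht : 0 < t) :
    Integrable fun x : ℝ ↦ Complex.exp (-(t * |x| : ℝ)) := by
  rw [← integrableOn_univ, ← Set.Iic_union_Ioi (a := (0 : ℝ)), integrableOn_union]
  constructor
  · refine (integrableOn_exp_mul_complex_Iic (a := t) (by simpa) 0).congr_fun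
      (fun x hx ↦ ?_) measurableSet_Iic
    simp [abs_of_nonpos (Set.mem_Iic.mp hx)]
  · refine (integrableOn_exp_mul_complex_Ioi (a := -t) (by simpa) 0).congr_fun
      (fun x hx ↦ ?_) measurableSet_Ioi
    simp [abs_of_pos (Set.mem_Ioi.mp hx)]

theorem fourier_cexp_neg_mul_abs {t : ℝ} (ht : 0 < t) :
    𝓕 (fun x : ℝ ↦ Complex.exp (-(t * |x| : ℝ))) =
      fun w : ℝ ↦ ((2 * t / ((2 * π * w) ^ 2 + t ^ 2) : ℝ) : ℂ) := by
  ext w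
  have h₁ : 0 < (t - 2 * π * w * Complex.I : ℂ).re := by simpa
  have h₂ : (-(t + 2 * π * w * Complex.I) : ℂ).re < 0 := by simpa
  have e₁ : Set.EqOn (fun x : ℝ ↦ Complex.exp (↑(-2 * π * x * w) * Complex.I) •
        Complex.exp (-(t * |x| : ℝ)))
      (fun x : ℝ ↦ Complex.exp ((t - 2 * π * w * Complex.I) * x)) (Set.Iic 0) := fun x hx ↦ by
    simp only [smul_eq_mul, ← Complex.exp_add, abs_of_nonpos (Set.mem_Iic.mp hx)]
    push_cast
    ring_nf
  have e₂ : Set.EqOn (fun x : ℝ ↦ Complex.exp (↑(-2 * π * x * w) * Complex.I) •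
        Complex.exp (-(t * |x| : ℝ)))
      (fun x : ℝ ↦ Complex.exp (-(t + 2 * π * w * Complex.I) * x)) (Set.Ioi 0) := fun x hx ↦ by
    simp only [smul_eq_mul, ← Complex.exp_add, abs_of_pos (Set.mem_Ioi.mp hx)]
    push_cast
    ring_nf
  rw [Real.fourier_real_eq_integral_exp_smul, ← intervalIntegral.integral_Iic_add_Ioi (b := 0)
      ((integrableOn_exp_mul_complex_Iic h₁ 0).congr_fun e₁.symm measurableSet_Iic)
      ((integrableOn_exp_mul_complex_Ioi h₂ 0).congr_fun e₂.symm measurableSet_Ioi),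
    setIntegral_congr_fun measurableSet_Iic e₁, setIntegral_congr_fun measurableSet_Ioi e₂,
    integral_exp_mul_complex_Iic h₁, integral_exp_mul_complex_Ioi h₂]
  have n₁ : (t - 2 * π * w * Complex.I : ℂ) ≠ 0 := fun h ↦ by simp [h] at h₁
  have n₂ : (t + 2 * π * w * Complex.I : ℂ) ≠ 0 := fun h ↦ by simp [h] at h₂
  have h : ((2 * π * w) ^ 2 + t ^ 2 : ℂ) =
      (t - 2 * π * w * Complex.I) * (t + 2 * π * w * Complex.I) := by
    linear_combination ((2 * π * w) ^ 2 : ℂ) * Complex.I_sq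
  push_cast
  rw [h]
  simp only [mul_zero, Complex.exp_zero, neg_div_neg_eq]
  field_simp
  ring

theorem integrable_div_sq_add_sq {t : ℝ} (ht : 0 < t) :
    Integrable fun w : ℝ ↦ 2 * t / ((2 * π * w) ^ 2 + t ^ 2) := by
  have h := (integrable_inv_one_add_sq.comp_mul_left'
    (R := 2 * π / t) (by positivity)).const_mul (2 / t)
  refine h.congr (.of_forall fun w ↦ ?_)
  field_simp
  ring

/-- The Fourier transform of the Poisson kernel `G(t,x) = (1/π) t/(x²+t²)` is `e^{-t|ξ|}`. -/
theorem fourier_poisson_kernel (t : ℝ) (ht : 0 < t) (ξ : ℝ) :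
    ∫ x : ℝ, (((1 / π) * (t / (x ^ 2 + t ^ 2)) : ℝ) : ℂ) * Complex.exp (-(Complex.I * x * ξ))
      = ((Real.exp (-(t * |ξ|)) : ℝ) : ℂ) := by
  have hcont : Continuous fun x : ℝ ↦ Complex.exp (-(t * |x| : ℝ)) := by fun_prop
  have hinv := congrFun (hcont.fourierInv_fourier_eq (integrable_cexp_neg_mul_abs ht)
    (by rw [fourier_cexp_neg_mul_abs ht]; exact (integrable_div_sq_add_sq ht).ofReal)) ξ
  rw [fourier_cexp_neg_mul_abs ht, Real.fourierInv_eq'] at hinv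
  have hscale := Measure.integral_comp_mul_left (fun x : ℝ ↦
    (((1 / π) * (t / (x ^ 2 + t ^ 2)) : ℝ) : ℂ) * Complex.exp (-(Complex.I * x * ξ))) (-(2 * π))
  rw [abs_inv, abs_neg, abs_of_pos two_pi_pos, eq_inv_smul_iff₀ two_pi_pos.ne',
    ← integral_smul] at hscale
  rw [← hscale, Complex.ofReal_exp, Complex.ofReal_neg, ← hinv]
  congr 1 with w
  have hπ : (π : ℂ) ≠ 0 := Complex.ofReal_ne_zero.mpr pi_ne_zero
  rw [Complex.real_smul, smul_eq_mul, ← mul_assoc, mul_comm (Complex.exp _)]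
  congr 1
  · push_cast
    rw [mul_assoc, neg_mul, neg_sq]
    field_simp
  · congr 1
    simp only [RCLike.inner_apply, conj_trivial]
    push_cast
    ring
end

section
/- For every x ∈ ℝ, ∫_ℝ sgn(ξ) · √|ξ| · e^{−|ξ|} · e^{−ixξ} dξ = i√π · Im((1+ix)^{−3/2}), where sgn(ξ) is 1 for ξ > 0, −1 for ξ < 0, and 0 for ξ = 0, and (1+ix)^{−3/2} is defined using the principal branch of the complex power. Equivalently, the left-hand side equals −i√π · sin((3/2)·arctan x)/(1+x²)^{3/4}. -/
open MeasureTheory Real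

/-- The Gamma integral with a complex rate `r` in the open right half-plane. -/
theorem integral_rpow_mul_cexp_neg_mul_Ioi {a : ℝ} {r : ℂ} (ha : 0 < a) (hr : 0 < r.re) :
    ∫ t in Set.Ioi (0 : ℝ), ((t ^ (a - 1) : ℝ) : ℂ) * Complex.exp (-(r * t)) =
      r ^ (-a : ℂ) * (Real.Gamma a : ℂ) := by
  set ν : Measure ℝ := (volume.restrict (Set.Ioi 0)).withDensity
    (fun t => ENNReal.ofReal (t ^ (a - 1))) with hν
  have hmeas : Measurable fun t : ℝ => ENNReal.ofReal (t ^ (a - 1)) := by fun_prop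
  have hset : Set.Iio 0 ⊆ interior (ProbabilityTheory.integrableExpSet id ν) := by
    refine interior_maximal (fun y hy => ?_) isOpen_Iio
    change Integrable _ ν
    rw [hν, integrable_withDensity_iff_integrable_smul' hmeas (by simp)]
    refine (integrableOn_rpow_mul_exp_neg_mul_rpow (s := a - 1) (p := 1) (b := -y)
      (by linarith) one_pos (neg_pos.2 hy)).congr_fun (fun t ht => ?_) measurableSet_Ioi
    simp [ENNReal.toReal_ofReal (rpow_nonneg (le_of_lt ht) _)]
  have hmgf (z : ℂ) : ProbabilityTheory.complexMGF id ν z =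
      ∫ t in Set.Ioi (0 : ℝ), ((t ^ (a - 1) : ℝ) : ℂ) * Complex.exp (z * t) := by
    rw [ProbabilityTheory.complexMGF, hν,
      integral_withDensity_eq_integral_toReal_smul hmeas (by simp)]
    refine setIntegral_congr_fun measurableSet_Ioi fun t ht => ?_
    simp [ENNReal.toReal_ofReal (rpow_nonneg (le_of_lt ht) _)]
  have hreal (y : ℝ) (hy : y < 0) : ProbabilityTheory.complexMGF id ν y =
      (-(y : ℂ)) ^ (-a : ℂ) * (Real.Gamma a : ℂ) := by
    have h := integral_rpow_mul_exp_neg_mul_Ioi ha (neg_pos.2 hy)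
    rw [one_div, inv_rpow (neg_pos.2 hy).le, ← rpow_neg (neg_pos.2 hy).le] at h
    rw [hmgf, ← Complex.ofReal_neg, ← Complex.ofReal_neg,
      ← Complex.ofReal_cpow (neg_pos.2 hy).le, ← Complex.ofReal_mul, ← h,
      ← integral_complex_ofReal]
    simp
  have hopen : IsOpen {z : ℂ | z.re < 0} := isOpen_lt Complex.continuous_re continuous_const
  have heq : Set.EqOn (ProbabilityTheory.complexMGF id ν)
      (fun z => (-z) ^ (-a : ℂ) * (Real.Gamma a : ℂ)) {z : ℂ | z.re < 0} := by
    refine AnalyticOnNhd.eqOn_of_preconnected_of_frequently_eq (z₀ := ((-1 : ℝ) : ℂ))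
      (ProbabilityTheory.analyticOnNhd_complexMGF.mono fun z hz => hset hz) ?_
      (convex_halfSpace_re_lt 0).isPreconnected (by simp) ?_
    · refine DifferentiableOn.analyticOnNhd (fun z hz => ?_) hopen
      refine DifferentiableAt.differentiableWithinAt ?_
      refine (DifferentiableAt.cpow_const (by fun_prop) (Or.inl ?_)).mul_const _
      simpa using hz
    · have ht : Filter.Tendsto ((↑) : ℝ → ℂ) (nhdsWithin (-1) {(-1)}ᶜ)
          (nhdsWithin ((-1 : ℝ) : ℂ) {((-1 : ℝ) : ℂ)}ᶜ) :=
        Complex.continuous_ofReal.continuousAt.tendsto.inf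
          (Filter.tendsto_principal_principal.2 fun y hy => by simpa [← Complex.ofReal_one,
            ← Complex.ofReal_neg, -Complex.ofReal_one] using hy)
      refine ht.frequently (Filter.Eventually.frequently ?_)
      filter_upwards [nhdsWithin_le_nhds (Iio_mem_nhds (show (-1 : ℝ) < 0 by norm_num))]
        with y hy using hreal y hy
  have := heq (x := -r) (by simpa using hr)
  simpa [hmgf] using this

theorem integral_sqrt_mul_exp_neg_mul_cexp_Ioi (x : ℝ) :
    ∫ ξ in Set.Ioi (0 : ℝ), ((√ξ * Real.exp (-ξ) : ℝ) : ℂ) *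
        Complex.exp (-(Complex.I * x * ξ)) =
      (1 + Complex.I * x) ^ (-(3 : ℂ) / 2) * ((√π / 2 : ℝ) : ℂ) := by
  have h := integral_rpow_mul_cexp_neg_mul_Ioi (a := 3 / 2) (r := 1 + Complex.I * x)
    (by norm_num) (by simp)
  have hG : Real.Gamma (3 / 2) = √π / 2 := by
    rw [show (3 / 2 : ℝ) = 1 / 2 + 1 by norm_num, Real.Gamma_add_one (by norm_num),
      Real.Gamma_one_half_eq]
    ring
  rw [hG, show (-((3 / 2 : ℝ) : ℂ)) = -(3 : ℂ) / 2 by push_cast; ring] at h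
  rw [← h]
  congr 1 with ξ
  rw [sqrt_eq_rpow, show (3 / 2 - 1 : ℝ) = 1 / 2 by norm_num, Complex.ofReal_mul, mul_assoc,
    Complex.ofReal_exp, ← Complex.exp_add]
  congr 2
  push_cast
  ring

theorem integrable_sign_mul_sqrt_abs_mul_exp_neg_abs_mul_cexp (x : ℝ) :
    Integrable fun ξ : ℝ => ((Real.sign ξ * √|ξ| * Real.exp (-|ξ|) : ℝ) : ℂ) *
      Complex.exp (-(Complex.I * x * ξ)) := by
  have hpos : IntegrableOn (fun ξ : ℝ => √|ξ| * Real.exp (-|ξ|)) (Set.Ioi 0) := by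
    refine (Real.GammaIntegral_convergent (s := 3 / 2) (by norm_num)).congr_fun
      (fun ξ hξ => ?_) measurableSet_Ioi
    have hξ' : 0 < ξ := hξ
    simp only [abs_of_pos hξ', sqrt_eq_rpow]
    norm_num [mul_comm]
  have hneg : IntegrableOn (fun ξ : ℝ => √|ξ| * Real.exp (-|ξ|)) (Set.Iio 0) := by
    have h : IntegrableOn (fun ξ : ℝ => √|ξ| * Real.exp (-|ξ|)) (Set.Ioi (-0)) := by
      simpa using hpos
    simpa using h.comp_neg_Iio
  have hint : Integrable fun ξ : ℝ => √|ξ| * Real.exp (-|ξ|) := by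
    rw [← integrableOn_univ, ← Set.Iic_union_Ioi (a := (0 : ℝ)), integrableOn_union,
      integrableOn_Iic_iff_integrableOn_Iio]
    exact ⟨hneg, hpos⟩
  have hsign : Measurable Real.sign :=
    Measurable.ite measurableSet_Iio measurable_const
      (Measurable.ite measurableSet_Ioi measurable_const measurable_const)
  refine hint.mono' (Measurable.aestronglyMeasurable (by fun_prop)) (.of_forall fun ξ => ?_)
  have hs : |Real.sign ξ| ≤ 1 := by
    rcases Real.sign_apply_eq ξ with h | h | h <;> simp [h]
  rw [norm_mul, Complex.norm_exp, Complex.norm_real, norm_mul, norm_mul]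
  simp only [norm_eq_abs, abs_exp, abs_of_nonneg (sqrt_nonneg _)]
  have : (-(Complex.I * x * ξ)).re = 0 := by simp
  rw [this, Real.exp_zero, mul_one, mul_assoc]
  exact mul_le_of_le_one_left (by positivity) hs

theorem im_one_add_I_mul_cpow (x s : ℝ) :
    ((1 + Complex.I * x) ^ (s : ℂ)).im =
      (1 + x ^ 2) ^ (s / 2) * Real.sin (s * Real.arctan x) := by
  have hz : (1 + Complex.I * x : ℂ) ≠ 0 := fun h => by
    simpa using congrArg Complex.re h
  have hnorm : ‖(1 + Complex.I * x : ℂ)‖ = √(1 + x ^ 2) := by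
    rw [Complex.norm_def, Complex.normSq_apply]
    simp [sq]
  have harg : Complex.arg (1 + Complex.I * x) = Real.arctan x := by
    rw [Complex.arg_of_re_nonneg (by simp), hnorm, arctan_eq_arcsin]
    simp
  have hx : 0 < 1 + x ^ 2 := by positivity
  rw [Complex.cpow_def_of_ne_zero hz, Complex.exp_im, Complex.re_mul_ofReal,
    Complex.im_mul_ofReal, Complex.log_re, Complex.log_im, harg, hnorm, log_sqrt hx.le,
    rpow_def_of_pos hx]
  ring_nf

/-- `∫_ℝ sgn(ξ) √|ξ| e^{-|ξ|} e^{-ixξ} dξ = i√π Im((1+ix)^{-3/2})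
     = -i√π sin((3/2) arctan x)/(1+x²)^{3/4}` (principal branch). -/
theorem fourier_sign_sqrt_abs_exp (x : ℝ) :
    (∫ ξ : ℝ, ((Real.sign ξ * Real.sqrt |ξ| * Real.exp (-|ξ|) : ℝ) : ℂ) *
          Complex.exp (-(Complex.I * x * ξ))
        = Complex.I * ((Real.sqrt π * ((1 + Complex.I * x) ^ (-(3 : ℂ) / 2)).im : ℝ) : ℂ))
    ∧ (∫ ξ : ℝ, ((Real.sign ξ * Real.sqrt |ξ| * Real.exp (-|ξ|) : ℝ) : ℂ) *
          Complex.exp (-(Complex.I * x * ξ))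
        = -(Complex.I *
            ((Real.sqrt π * (Real.sin ((3 / 2) * Real.arctan x) / (1 + x ^ 2) ^ ((3 : ℝ) / 4)) : ℝ) : ℂ))) := by
  have hI := integral_sqrt_mul_exp_neg_mul_cexp_Ioi
  have hf := integrable_sign_mul_sqrt_abs_mul_exp_neg_abs_mul_cexp x
  have hIoi : ∫ ξ in Set.Ioi (0 : ℝ), ((Real.sign ξ * √|ξ| * Real.exp (-|ξ|) : ℝ) : ℂ) *
      Complex.exp (-(Complex.I * x * ξ)) =
      (1 + Complex.I * x) ^ (-(3 : ℂ) / 2) * ((√π / 2 : ℝ) : ℂ) := by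
    rw [← hI]
    refine setIntegral_congr_fun measurableSet_Ioi fun ξ hξ => ?_
    have hξ' : 0 < ξ := hξ
    simp [Real.sign_of_pos hξ', abs_of_pos hξ']
  have hIic : ∫ ξ in Set.Iic (0 : ℝ), ((Real.sign ξ * √|ξ| * Real.exp (-|ξ|) : ℝ) : ℂ) *
      Complex.exp (-(Complex.I * x * ξ)) =
      -((starRingEnd ℂ) ((1 + Complex.I * x) ^ (-(3 : ℂ) / 2)) * ((√π / 2 : ℝ) : ℂ)) := by
    have harg : (1 + Complex.I * x : ℂ).arg ≠ π :=
      Complex.mem_slitPlane_iff_arg.1 (Or.inl (by simp)) |>.1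
    have hconj : (starRingEnd ℂ) ((1 + Complex.I * x) ^ (-(3 : ℂ) / 2)) =
        (1 + Complex.I * (-x : ℝ)) ^ (-(3 : ℂ) / 2) := by
      have h := Complex.conj_cpow (1 + Complex.I * x) (-(3 : ℂ) / 2) harg
      have h3 : (starRingEnd ℂ) (-(3 : ℂ) / 2) = -(3 : ℂ) / 2 := by
        simp [Complex.conj_ofNat]
      rw [h3] at h
      rw [← h]
      simp
    rw [hconj, ← hI, ← integral_neg, ← neg_zero, ← integral_comp_neg_Ioi, neg_zero]
    refine setIntegral_congr_fun measurableSet_Ioi fun ξ hξ => ?_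
    have hξ' : 0 < ξ := hξ
    simp [Real.sign_of_neg (neg_neg_of_pos hξ'), abs_of_pos hξ']
  have hmain : ∫ ξ : ℝ, ((Real.sign ξ * Real.sqrt |ξ| * Real.exp (-|ξ|) : ℝ) : ℂ) *
          Complex.exp (-(Complex.I * x * ξ))
        = Complex.I * ((Real.sqrt π * ((1 + Complex.I * x) ^ (-(3 : ℂ) / 2)).im : ℝ) : ℂ) := by
    rw [← intervalIntegral.integral_Iic_add_Ioi hf.integrableOn hf.integrableOn, hIoi, hIic]
    have h := Complex.sub_conj ((1 + Complex.I * x) ^ (-(3 : ℂ) / 2))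
    push_cast at h ⊢
    linear_combination (√π / 2 : ℂ) * h
  refine ⟨hmain, hmain.trans ?_⟩
  have him := im_one_add_I_mul_cpow x (-(3 / 2))
  rw [show ((-(3 / 2) : ℝ) : ℂ) = -(3 : ℂ) / 2 by push_cast; ring, neg_mul, Real.sin_neg,
    show (-(3 / 2) / 2 : ℝ) = -(3 / 4) by norm_num, rpow_neg (by positivity)] at him
  rw [him]
  push_cast
  ring
end

section
/- Let k⁺(x) = Re((1+ix)^{−3/2}) for x ∈ ℝ (principal branch), and set M⁺[w](t) = ∫_ℝ k⁺(x) w(tx) dx. Define the Fourier transform F f(ξ) = ∫_ℝ f(x) e^{−iξx} dx and its inverse F⁻¹f(x) = (1/2π)∫_ℝ f(ξ) e^{iξx} dξ. Then for all real-valued, even Schwartz functions v, w on ℝ, ∫_ℝ v(t) · M⁺[w](t) dt = ∫_ℝ M⁺[F⁻¹v](y) · (F w)(y) dy. In other words, on even real functions the adjoint of M⁺ with respect to the L² inner product is F⁻¹ ∘ M⁺ ∘ F⁻¹. -/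
open MeasureTheory Real

/-- `k⁺(x) = Re((1+ix)^{-3/2})` (principal branch). -/
noncomputable def kplus (x : ℝ) : ℝ := ((1 + Complex.I * x) ^ (-(3 : ℂ) / 2)).re

/-- `M⁺[w](t) = ∫_ℝ k⁺(x) w(tx) dx`. -/
noncomputable def Mplus (w : ℝ → ℝ) (t : ℝ) : ℝ := ∫ x : ℝ, kplus x * w (t * x)

/-- Complex-valued version of `M⁺`. -/
noncomputable def MplusC (w : ℝ → ℂ) (t : ℝ) : ℂ := ∫ x : ℝ, (kplus x : ℂ) * w (t * x)

/-- Fourier transform with normalization `F f ξ = ∫ f x e^{-iξx} dx`. -/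
noncomputable def FT (f : ℝ → ℂ) (ξ : ℝ) : ℂ :=
  ∫ x : ℝ, f x * Complex.exp (-(Complex.I * ξ * x))

/-- Inverse Fourier transform `F⁻¹ f x = (1/2π) ∫ f ξ e^{iξx} dξ`. -/
noncomputable def FTinv (f : ℝ → ℂ) (x : ℝ) : ℂ :=
  (1 / (2 * π)) * ∫ ξ : ℝ, f ξ * Complex.exp (Complex.I * ξ * x)

/-- The complexification of a real-valued Schwartz function. -/
noncomputable def complexify (f : SchwartzMap ℝ ℝ) : SchwartzMap ℝ ℂ :=
  f.postcompCLM (𝕜 := ℝ) Complex.ofRealCLM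

lemma measurable_kplus : Measurable kplus := by
  unfold kplus
  fun_prop

lemma norm_kplus_le (x : ℝ) : ‖kplus x‖ ≤ (1 + ‖x‖ ^ 2) ^ (-(3 / 2 : ℝ) / 2) := by
  have hsq : ‖(1 + Complex.I * x : ℂ)‖ ^ 2 = 1 + ‖x‖ ^ 2 := by
    rw [Complex.sq_norm, Complex.normSq_apply]
    simp
    ring
  have hexp : (-(3 : ℂ) / 2) = ((-(3 / 2) : ℝ) : ℂ) := by push_cast; ring
  calc ‖kplus x‖ ≤ ‖(1 + Complex.I * x : ℂ) ^ (-(3 : ℂ) / 2)‖ := Complex.abs_re_le_norm _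
    _ = ‖(1 + Complex.I * x : ℂ)‖ ^ (-(3 / 2) : ℝ) := by rw [hexp, Complex.norm_cpow_real]
    _ = (1 + ‖x‖ ^ 2) ^ (-(3 / 2 : ℝ) / 2) := by
      rw [← hsq, ← Real.rpow_natCast, ← Real.rpow_mul (norm_nonneg _)]
      congr 1
      push_cast
      ring

lemma integrable_kplus : Integrable kplus :=
  (integrable_rpow_neg_one_add_norm_sq (by norm_num)).mono'
    measurable_kplus.aestronglyMeasurable (.of_forall norm_kplus_le)

/-- Fubini for two integrable functions coupled through a bounded continuous kernel. -/
lemma integral_mul_integral_mul_swap {f g : ℝ → ℂ} {h : ℝ → ℝ → ℂ} {C : ℝ}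
    (hf : Integrable f) (hg : Integrable g) (hh : Continuous h.uncurry)
    (hC : ∀ a b, ‖h a b‖ ≤ C) :
    ∫ a, f a * ∫ b, g b * h a b = ∫ b, g b * ∫ a, f a * h a b := by
  have hint : Integrable (fun p : ℝ × ℝ => f p.1 * g p.2 * h p.1 p.2) (volume.prod volume) :=
    (hf.mul_prod hg).mul_bdd hh.aestronglyMeasurable (.of_forall fun p => hC p.1 p.2)
  calc ∫ a, f a * ∫ b, g b * h a b = ∫ a, ∫ b, f a * g b * h a b := by
        simp only [← integral_const_mul, mul_assoc]
    _ = ∫ b, ∫ a, f a * g b * h a b := integral_integral_swap hint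
    _ = ∫ b, g b * ∫ a, f a * h a b := by
        simp only [← integral_const_mul, mul_assoc, mul_left_comm]

open scoped FourierTransform in
lemma FT_eq_fourier (f : ℝ → ℂ) (ξ : ℝ) : FT f ξ = 𝓕 f (ξ / (2 * π)) := by
  rw [FT, Real.fourier_real_eq_integral_exp_smul]
  congr 1 with x
  rw [smul_eq_mul, mul_comm]
  congr 2
  push_cast
  field_simp

open scoped FourierTransform in
lemma FTinv_eq_fourierInv (f : ℝ → ℂ) (x : ℝ) :
    FTinv f x = (1 / (2 * π)) * 𝓕⁻ f (x / (2 * π)) := by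
  rw [FTinv, Real.fourierInv_eq']
  congr 2 with ξ
  rw [smul_eq_mul, mul_comm]
  congr 2
  simp only [RCLike.inner_apply, conj_trivial]
  push_cast
  field_simp

open scoped FourierTransform in
lemma FT_coe_schwartz (f : SchwartzMap ℝ ℂ) : FT f = fun ξ => (𝓕 f) (ξ / (2 * π)) := by
  ext ξ
  rw [FT_eq_fourier, SchwartzMap.fourier_coe]

open scoped FourierTransform in
lemma integrable_FT (f : SchwartzMap ℝ ℂ) : Integrable (FT f) := by
  rw [FT_coe_schwartz]
  exact (𝓕 f).integrable.comp_div (by positivity)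

open scoped FourierTransform in
lemma continuous_FTinv (f : SchwartzMap ℝ ℂ) : Continuous (FTinv f) := by
  have h : FTinv f = fun x : ℝ => (1 / (2 * π) : ℂ) * (𝓕⁻ f) (x / (2 * π)) := by
    ext x
    rw [FTinv_eq_fourierInv, SchwartzMap.fourierInv_coe]
  rw [h]
  exact continuous_const.mul ((𝓕⁻ f).continuous.comp (continuous_id.div_const _))

lemma norm_exp_I_mul_mul (a b : ℝ) : ‖Complex.exp (Complex.I * a * b)‖ = 1 := by
  rw [show Complex.I * a * b = ((a * b : ℝ) : ℂ) * Complex.I by push_cast; ring]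
  exact Complex.norm_exp_ofReal_mul_I _

lemma norm_FTinv_le (f : ℝ → ℂ) (x : ℝ) :
    ‖FTinv f x‖ ≤ ‖(1 / (2 * π) : ℂ)‖ * ∫ ξ, ‖f ξ‖ := by
  rw [FTinv, norm_mul]
  gcongr
  refine (norm_integral_le_integral_norm _).trans_eq ?_
  simp only [norm_mul, norm_exp_I_mul_mul, mul_one]

open scoped FourierTransform in
lemma FTinv_FT (f : SchwartzMap ℝ ℂ) (x : ℝ) : FTinv (FT f) x = f x := by
  have hinv : 𝓕⁻ ((𝓕 f : SchwartzMap ℝ ℂ) : ℝ → ℂ) x = f x := by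
    rw [← SchwartzMap.fourierInv_coe, FourierTransform.fourierInv_fourier_eq]
  rw [← hinv, Real.fourierInv_eq', FTinv, FT_coe_schwartz]
  have h := Measure.integral_comp_div
    (fun η : ℝ => Complex.exp (↑(2 * π * inner ℝ η x) * Complex.I) • (𝓕 f) η) (2 * π)
  have hcongr : (∫ ξ : ℝ, (𝓕 f) (ξ / (2 * π)) * Complex.exp (Complex.I * ξ * x)) =
      ∫ ξ : ℝ, Complex.exp (↑(2 * π * inner ℝ (ξ / (2 * π)) x) * Complex.I) •
        (𝓕 f) (ξ / (2 * π)) := by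
    congr 1 with ξ
    rw [smul_eq_mul, mul_comm]
    congr 2
    simp only [RCLike.inner_apply, conj_trivial]
    push_cast
    field_simp
  rw [hcongr, h, abs_of_pos (by positivity), Complex.real_smul, ← mul_assoc,
    show (1 / (2 * π) : ℂ) * ((2 * π : ℝ) : ℂ) = 1 by push_cast; field_simp, one_mul]

/-- A dilated Parseval identity, valid also for the dilation factor `x = 0`. -/
lemma integral_FT_mul_FTinv_comp_mul (f g : SchwartzMap ℝ ℂ) (x : ℝ) :
    ∫ y, FT g y * FTinv f (y * x) = ∫ t, f t * g (t * x) := by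
  have hcont : Continuous (Function.uncurry fun y t : ℝ =>
      Complex.exp (Complex.I * t * (y * x : ℝ))) := by
    unfold Function.uncurry
    fun_prop
  have hswap := integral_mul_integral_mul_swap (integrable_FT g) f.integrable hcont
    (fun y t => (norm_exp_I_mul_mul t (y * x)).le)
  calc ∫ y, FT g y * FTinv f (y * x)
      = (1 / (2 * π)) * ∫ y, FT g y * ∫ t, f t * Complex.exp (Complex.I * t * (y * x : ℝ)) := by
        rw [← integral_const_mul]
        congr 1 with y
        rw [FTinv]
        ring
    _ = ∫ t, f t * FTinv (FT g) (t * x) := by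
        rw [hswap, ← integral_const_mul]
        congr 1 with t
        have hexp : ∀ y : ℝ, Complex.exp (Complex.I * t * (y * x : ℝ)) =
            Complex.exp (Complex.I * y * (t * x : ℝ)) := fun y => by
          congr 1
          push_cast
          ring
        simp only [FTinv, hexp]
        ring
    _ = ∫ t, f t * g (t * x) := by simp only [FTinv_FT]

/-- `F⁻¹ ∘ M⁺ ∘ F⁻¹` is the transpose of `M⁺` on all complex Schwartz functions. -/
lemma integral_mul_MplusC (f g : SchwartzMap ℝ ℂ) :
    ∫ t, f t * MplusC g t = ∫ y, MplusC (FTinv f) y * FT g y := by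
  have hk : Integrable fun x => (kplus x : ℂ) := integrable_kplus.ofReal
  have hmul : Continuous (Function.uncurry fun a b : ℝ => a * b) := continuous_mul
  have hl := integral_mul_integral_mul_swap (h := fun t x => g (t * x)) f.integrable hk
    (g.continuous.comp hmul) (fun t x => g.toBoundedContinuousFunction.norm_coe_le_norm (t * x))
  have hr := integral_mul_integral_mul_swap (h := fun y x => FTinv f (y * x)) (integrable_FT g) hk
    ((continuous_FTinv f).comp hmul) (fun y x => norm_FTinv_le f (y * x))
  simp only [integral_FT_mul_FTinv_comp_mul] at hr
  simp only [MplusC, mul_comm _ (FT (⇑g) _)]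
  rw [hl, hr]

lemma ofReal_Mplus (w : ℝ → ℝ) (t : ℝ) :
    (Mplus w t : ℂ) = MplusC (fun x => (w x : ℂ)) t := by
  simp only [Mplus, MplusC, ← integral_complex_ofReal, Complex.ofReal_mul]

/-- On even real functions, the adjoint of `M⁺` with respect to the `L²` inner product
is `F⁻¹ ∘ M⁺ ∘ F⁻¹`:  `∫ v(t) M⁺[w](t) dt = ∫ M⁺[F⁻¹v](y) (F w)(y) dy`
for all real-valued even Schwartz functions `v, w`. -/
theorem Mplus_adjoint (v w : SchwartzMap ℝ ℝ)
    (hv : ∀ x : ℝ, v (-x) = v x) (hw : ∀ x : ℝ, w (-x) = w x) :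
    ((∫ t : ℝ, v t * Mplus (fun x => w x) t : ℝ) : ℂ)
      = ∫ y : ℝ, MplusC (FTinv fun x => ((v x : ℝ) : ℂ)) y * FT (fun x => ((w x : ℝ) : ℂ)) y := by
  rw [← integral_complex_ofReal]
  simp only [Complex.ofReal_mul, ofReal_Mplus]
  exact integral_mul_MplusC (complexify v) (complexify w)
end

section
/- Define u : ℝ → ℝ by u(t) = 1 for |t| ≤ 1 and u(t) = |t|^{−1/2} for |t| > 1. Then there exists a constant C > 0 such that for every t ∈ ℝ with |t| ≥ 2, the function s ↦ (u(t) − u(s))/|t − s|^{3/2} is Lebesgue integrable on ℝ and |∫_ℝ (u(t) − u(s))/|t − s|^{3/2} ds| ≤ C |t|^{−3/2}. -/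
open MeasureTheory Real

/-- The profile `u(t) = 1` for `|t| ≤ 1` and `u(t) = |t|^{-1/2}` for `|t| > 1`. -/
noncomputable def uProfile (t : ℝ) : ℝ := if |t| ≤ 1 then 1 else |t| ^ (-(1 : ℝ) / 2)

/-- A fixed integrable function dominating `|x|^{-1/2} + 1` near the origin and `|x|^{-3/2}` away
from it. -/
theorem exists_integrable_dominating_kernel :
    ∃ k : ℝ → ℝ, Integrable k ∧ (∀ x, 0 ≤ k x) ∧
      (∀ x, |x| ≤ 1 → |x| ^ (-(1 : ℝ) / 2) + 1 ≤ k x) ∧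
      (∀ x, 1 < |x| → |x| ^ (-(3 : ℝ) / 2) ≤ k x) := by
  set F : ℝ → ℝ := fun x =>
    (Set.Icc (0 : ℝ) 1).indicator (fun x => x ^ (-(1 : ℝ) / 2) + 1) x +
      (Set.Ioi (1 : ℝ)).indicator (fun x => x ^ (-(3 : ℝ) / 2)) x with hF
  have hFint : Integrable F := by
    refine Integrable.add ?_ ?_
    · rw [integrable_indicator_iff measurableSet_Icc]
      refine Integrable.add ?_ ?_
      · have h := intervalIntegral.intervalIntegrable_rpow' (a := 0) (b := 1)
          (r := -(1 : ℝ) / 2) (by norm_num)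
        rwa [intervalIntegrable_iff_integrableOn_Icc_of_le zero_le_one] at h
      · exact integrableOn_const (by simp)
    · rw [integrable_indicator_iff measurableSet_Ioi]
      exact integrableOn_Ioi_rpow_of_lt (by norm_num) one_pos
  have hF0 : ∀ x, 0 ≤ F x := fun x => by
    refine add_nonneg (Set.indicator_nonneg (fun y hy => ?_) x)
      (Set.indicator_nonneg (fun y hy => ?_) x)
    · have := rpow_nonneg hy.1 (-(1 : ℝ) / 2)
      linarith
    · exact rpow_nonneg (zero_le_one.trans (le_of_lt hy)) _
  have hFabs : ∀ x, F |x| ≤ F x + F (-x) := fun x => by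
    rcases abs_choice x with h | h <;> rw [h]
    · linarith [hF0 (-x)]
    · linarith [hF0 x]
  refine ⟨fun x => F x + F (-x), hFint.add hFint.comp_neg,
    fun x => add_nonneg (hF0 _) (hF0 _), fun x hx => le_trans ?_ (hFabs x),
    fun x hx => le_trans ?_ (hFabs x)⟩
  · simp [hF, hx, abs_nonneg x, not_lt.2 hx]
  · simp [hF, hx, not_le.2 hx]

theorem uProfile_eq_max_rpow (t : ℝ) : uProfile t = max 1 |t| ^ (-(1 : ℝ) / 2) := by
  unfold uProfile
  split_ifs with h
  · rw [max_eq_left h, one_rpow]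
  · rw [max_eq_right (not_le.1 h).le]

theorem rpow_neg_half_eq_inv_sqrt {a : ℝ} (ha : 0 ≤ a) : a ^ (-(1 : ℝ) / 2) = (√a)⁻¹ := by
  rw [neg_div, rpow_neg ha, sqrt_eq_rpow]

theorem uProfile_pos (t : ℝ) : 0 < uProfile t := by
  rw [uProfile_eq_max_rpow]
  exact rpow_pos_of_pos (lt_max_of_lt_left one_pos) _

theorem uProfile_le_one (t : ℝ) : uProfile t ≤ 1 := by
  rw [uProfile_eq_max_rpow]
  exact rpow_le_one_of_one_le_of_nonpos (le_max_left _ _) (by norm_num)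

theorem measurable_uProfile : Measurable uProfile := by
  rw [funext uProfile_eq_max_rpow]
  fun_prop

theorem abs_inv_sqrt_sub_inv_sqrt_le {a b : ℝ} (ha : 1 ≤ a) (hb : 1 ≤ b) :
    |(√a)⁻¹ - (√b)⁻¹| ≤ |a - b| := by
  have hp : 1 ≤ √a := one_le_sqrt.2 ha
  have hq : 1 ≤ √b := one_le_sqrt.2 hb
  have hab : a - b = (√a - √b) * (√a + √b) := by
    ring_nf
    rw [sq_sqrt (by linarith), sq_sqrt (by linarith)]
  have hinv : (√a)⁻¹ - (√b)⁻¹ = -(√a - √b) / (√a * √b) := by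
    field_simp
    ring
  rw [hab, hinv, abs_div, abs_neg, abs_mul (√a - √b)]
  have h1 : 1 ≤ |√a * √b| := by
    rw [abs_of_pos (by positivity)]
    nlinarith
  have h2 : 1 ≤ |√a + √b| := by
    rw [abs_of_pos (by positivity)]
    linarith
  exact (div_le_self (abs_nonneg _) h1).trans (le_mul_of_one_le_right (abs_nonneg _) h2)

theorem abs_uProfile_sub_le (t s : ℝ) : |uProfile t - uProfile s| ≤ |t - s| := by
  have h : ∀ x : ℝ, uProfile x = (√(max 1 |x|))⁻¹ := fun x => by
    rw [uProfile_eq_max_rpow, rpow_neg_half_eq_inv_sqrt (by positivity)]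
  rw [h, h]
  calc _ ≤ |(max 1 |t|) - (max 1 |s|)| :=
        abs_inv_sqrt_sub_inv_sqrt_le (le_max_left _ _) (le_max_left _ _)
    _ ≤ |(|t|) - (|s|)| := by
        simpa using abs_max_sub_max_le_max 1 |t| 1 |s|
    _ ≤ |t - s| := abs_abs_sub_abs_le _ _

theorem abs_uProfile_sub_le_one (t s : ℝ) : |uProfile t - uProfile s| ≤ 1 := by
  rw [abs_le]
  constructor <;>
    linarith [uProfile_pos t, uProfile_pos s, uProfile_le_one t, uProfile_le_one s]

theorem integrable_uProfile_quotient (t : ℝ) :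
    Integrable (fun s : ℝ => (uProfile t - uProfile s) / |t - s| ^ ((3 : ℝ) / 2)) := by
  obtain ⟨k, hk, hk0, hk1, hk2⟩ := exists_integrable_dominating_kernel
  refine (hk.comp_sub_left t).mono' ?_ (Filter.Eventually.of_forall fun s => ?_)
  · have := measurable_uProfile
    exact Measurable.aestronglyMeasurable (by fun_prop)
  rw [norm_div, Real.norm_eq_abs, Real.norm_eq_abs,
    abs_of_nonneg (rpow_nonneg (abs_nonneg (t - s)) _)]
  rcases (abs_nonneg (t - s)).eq_or_lt with h0 | h0
  · rw [← h0, zero_rpow (by norm_num), div_zero]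
    exact hk0 _
  rcases le_or_gt |t - s| 1 with h | h
  · calc _ ≤ |t - s| / |t - s| ^ ((3 : ℝ) / 2) := by
          exact div_le_div_of_nonneg_right (abs_uProfile_sub_le t s) (by positivity)
      _ = |t - s| ^ (-(1 : ℝ) / 2) := by
          nth_rewrite 1 [← rpow_one |t - s|]
          rw [← rpow_sub h0]
          norm_num
      _ ≤ k (t - s) := by linarith [hk1 _ h]
  · calc _ ≤ 1 / |t - s| ^ ((3 : ℝ) / 2) := by
          gcongr
          exact abs_uProfile_sub_le_one t s
      _ = |t - s| ^ (-(3 : ℝ) / 2) := by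
          rw [neg_div, rpow_neg h0.le, one_div]
      _ ≤ k (t - s) := hk2 _ h

theorem rpow_three_halves_sq {p : ℝ} (hp : 0 ≤ p) : (p ^ 2) ^ ((3 : ℝ) / 2) = p ^ 3 := by
  rw [← rpow_natCast, ← rpow_mul hp, ← rpow_natCast]
  norm_num

/-- The inversion `x ↦ t² / x` reverses the sign of the integrand defining `(-Δ)^{1/4}` of
`|·|^{-1/2}` at `t`. -/
theorem inversion_quotient {t x : ℝ} (ht : t ≠ 0) (hx : x ≠ 0) :
    |-(t ^ 2 / x ^ 2)| •
        ((|t| ^ (-(1 : ℝ) / 2) - |t ^ 2 / x| ^ (-(1 : ℝ) / 2)) /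
          |t - t ^ 2 / x| ^ ((3 : ℝ) / 2)) =
      -((|t| ^ (-(1 : ℝ) / 2) - |x| ^ (-(1 : ℝ) / 2)) / |t - x| ^ ((3 : ℝ) / 2)) := by
  have hdiff : |t - t ^ 2 / x| = |t| / |x| * |t - x| := by
    rw [← abs_div, ← abs_mul, ← abs_neg]
    congr 1
    field_simp
    ring
  have hjac : |-(t ^ 2 / x ^ 2)| = |t| ^ 2 / |x| ^ 2 := by
    rw [abs_neg, abs_div, abs_pow, abs_pow]
  rw [hdiff, hjac, abs_div, abs_pow, smul_eq_mul, mul_rpow (by positivity) (by positivity)]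
  obtain ⟨p, hp, hpt⟩ : ∃ p : ℝ, 0 < p ∧ |t| = p ^ 2 :=
    ⟨√|t|, sqrt_pos.2 (abs_pos.2 ht), (sq_sqrt (abs_nonneg t)).symm⟩
  obtain ⟨q, hq, hqx⟩ : ∃ q : ℝ, 0 < q ∧ |x| = q ^ 2 :=
    ⟨√|x|, sqrt_pos.2 (abs_pos.2 hx), (sq_sqrt (abs_nonneg x)).symm⟩
  have hpq : (p ^ 2) ^ 2 / q ^ 2 = (p ^ 2 / q) ^ 2 := by ring
  rw [hpt, hqx, hpq, div_rpow (sq_nonneg p) (sq_nonneg q), rpow_three_halves_sq hp.le, rpow_three_halves_sq hq.le,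
    rpow_neg_half_eq_inv_sqrt (by positivity), rpow_neg_half_eq_inv_sqrt (by positivity),
    rpow_neg_half_eq_inv_sqrt (by positivity), sqrt_sq hp.le, sqrt_sq hq.le,
    sqrt_sq (by positivity)]
  generalize |t - x| ^ ((3 : ℝ) / 2) = D
  rcases eq_or_ne D 0 with rfl | hD
  · simp
  · field_simp
    ring

/-- `|·|^{-1/2}` is annihilated by the quarter-Laplacian away from the origin. -/
theorem integral_rpow_neg_half_quotient_eq_zero {t : ℝ} (ht : t ≠ 0) :
    ∫ s : ℝ, (|t| ^ (-(1 : ℝ) / 2) - |s| ^ (-(1 : ℝ) / 2)) / |t - s| ^ ((3 : ℝ) / 2) = 0 := by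
  set g : ℝ → ℝ := fun s =>
    (|t| ^ (-(1 : ℝ) / 2) - |s| ^ (-(1 : ℝ) / 2)) / |t - s| ^ ((3 : ℝ) / 2) with hg
  have hinvol : ∀ x : ℝ, x ≠ 0 → t ^ 2 / (t ^ 2 / x) = x := fun x hx => by field_simp
  have himage : (fun x : ℝ => t ^ 2 / x) '' {0}ᶜ = {0}ᶜ := by
    ext y
    constructor
    · rintro ⟨x, hx, rfl⟩
      exact div_ne_zero (pow_ne_zero 2 ht) hx
    · intro hy
      exact ⟨t ^ 2 / y, div_ne_zero (pow_ne_zero 2 ht) hy, hinvol y hy⟩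
  have hcv := integral_image_eq_integral_abs_deriv_smul (s := {0}ᶜ)
    (f := fun x : ℝ => t ^ 2 / x) (f' := fun x => -(t ^ 2 / x ^ 2))
    (measurableSet_singleton 0).compl
    (fun x hx => by
      have h := ((hasDerivAt_inv hx).const_mul (t ^ 2)).hasDerivWithinAt (s := {0}ᶜ)
      simpa [div_eq_mul_inv] using h)
    (fun x hx y hy hxy => by
      have hxy' : t ^ 2 / x = t ^ 2 / y := hxy
      rw [← hinvol x hx, hxy', hinvol y hy]) g
  rw [himage, setIntegral_congr_fun (measurableSet_singleton 0).compl
    (fun x hx => inversion_quotient ht hx), integral_neg,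
    restrict_compl_singleton] at hcv
  change ∫ s, g s = 0
  change ∫ s, g s = -∫ s, g s at hcv
  linarith

/-- **Decay of the quarter-Laplacian of `uProfile`.** There is `C > 0` such that for
`|t| ≥ 2` the integrand of `(-Δ)^{1/4} u(t)` is integrable and
`|∫ (u(t)-u(s))/|t-s|^{3/2} ds| ≤ C |t|^{-3/2}`. -/
theorem quarterLaplacian_decay_uProfile :
    ∃ C : ℝ, 0 < C ∧ ∀ t : ℝ, 2 ≤ |t| →
      Integrable (fun s : ℝ => (uProfile t - uProfile s) / |t - s| ^ ((3 : ℝ) / 2)) ∧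
      |∫ s : ℝ, (uProfile t - uProfile s) / |t - s| ^ ((3 : ℝ) / 2)|
        ≤ C * |t| ^ (-(3 : ℝ) / 2) := by
  obtain ⟨k, hk, hk0, hk1, -⟩ := exists_integrable_dominating_kernel
  have hI : 0 ≤ ∫ s, k s := integral_nonneg hk0
  refine ⟨2 ^ ((3 : ℝ) / 2) * (∫ s, k s) + 1, by positivity, fun t ht =>
    ⟨integrable_uProfile_quotient t, ?_⟩⟩
  have ht0 : 0 < |t| := by linarith
  set h : ℝ → ℝ := fun s =>
    (|s| ^ (-(1 : ℝ) / 2) - uProfile s) / |t - s| ^ ((3 : ℝ) / 2) with hh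
  have hbound : ∀ s, ‖h s‖ ≤ 2 ^ ((3 : ℝ) / 2) * |t| ^ (-(3 : ℝ) / 2) * k s := fun s => by
    have hrhs : 0 ≤ 2 ^ ((3 : ℝ) / 2) * |t| ^ (-(3 : ℝ) / 2) * k s :=
      mul_nonneg (by positivity) (hk0 s)
    rcases le_or_gt |s| 1 with hs | hs
    · have hnum : |(|s| ^ (-(1 : ℝ) / 2) - uProfile s)| ≤ k s := by
        have := rpow_nonneg (abs_nonneg s) (-(1 : ℝ) / 2)
        rw [abs_le]
        constructor <;> linarith [hk1 s hs, uProfile_pos s, uProfile_le_one s]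
      have hden : |t| / 2 ≤ |t - s| := by linarith [abs_sub_abs_le_abs_sub t s]
      rw [hh, norm_div, Real.norm_eq_abs, Real.norm_eq_abs,
        abs_of_nonneg (rpow_nonneg (abs_nonneg (t - s)) _)]
      calc _ ≤ k s / (|t| / 2) ^ ((3 : ℝ) / 2) := by
            gcongr
            exact hk0 s
        _ = _ := by
            rw [div_rpow ht0.le two_pos.le, neg_div, rpow_neg ht0.le]
            field_simp
    · have : h s = 0 := by simp [hh, uProfile, not_le.2 hs]
      rwa [this, norm_zero]
  have hdom := hk.const_mul (2 ^ ((3 : ℝ) / 2) * |t| ^ (-(3 : ℝ) / 2))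
  have hhint : Integrable h := by
    refine hdom.mono' ?_ (Filter.Eventually.of_forall hbound)
    have := measurable_uProfile
    exact Measurable.aestronglyMeasurable (by fun_prop)
  have hut : uProfile t = |t| ^ (-(1 : ℝ) / 2) := if_neg (by linarith)
  have hsplit : ∫ s, (uProfile t - uProfile s) / |t - s| ^ ((3 : ℝ) / 2) = ∫ s, h s := by
    have hsub := integral_sub (integrable_uProfile_quotient t) hhint
    have hzero := integral_rpow_neg_half_quotient_eq_zero (abs_pos.1 ht0)
    rw [← sub_eq_zero, ← hsub, ← hzero]
    congr 1 with s
    rw [hh, hut]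
    ring
  rw [hsplit]
  calc |∫ s, h s| ≤ ∫ s, 2 ^ ((3 : ℝ) / 2) * |t| ^ (-(3 : ℝ) / 2) * k s :=
        norm_integral_le_of_norm_le hdom (Filter.Eventually.of_forall hbound)
    _ = 2 ^ ((3 : ℝ) / 2) * (∫ s, k s) * |t| ^ (-(3 : ℝ) / 2) := by
        rw [integral_const_mul]
        ring
    _ ≤ _ := by
        gcongr
        linarith
end

section
/- Define v : ℝ → ℝ by v(t) = (1 + t²)^{−3/8}. Then there exists a constant C > 0 such that for every t ∈ ℝ with |t| ≥ 2, the function s ↦ (v(t) − v(s))/|t − s|^{3/2} is Lebesgue integrable on ℝ and |∫_ℝ (v(t) − v(s))/|t − s|^{3/2} ds| ≤ C |t|^{−5/4}. -/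
open MeasureTheory Real

/-- The profile `v(t) = (1+t²)^{-3/8}`. -/
noncomputable def vProfile (t : ℝ) : ℝ := (1 + t ^ 2) ^ (-(3 : ℝ) / 8)

/-- The even extension of a function integrable on the positive half-line is integrable. -/
lemma integrable_comp_abs_of_integrableOn_Ioi {f : ℝ → ℝ}
    (hf : IntegrableOn f (Set.Ioi 0)) : Integrable fun x : ℝ => f |x| := by
  have hpos : IntegrableOn (fun x : ℝ => f |x|) (Set.Ioi 0) :=
    hf.congr_fun (fun x hx => by simp only [abs_of_pos (Set.mem_Ioi.mp hx)]) measurableSet_Ioi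
  have hneg : IntegrableOn (fun x : ℝ => f |x|) (Set.Iic 0) := by
    rw [integrableOn_Iic_iff_integrableOn_Iio]
    have h := (integrable_indicator_iff measurableSet_Ioi).mpr hpos
    rw [← integrable_indicator_iff measurableSet_Iio]
    refine h.comp_neg.congr (Filter.Eventually.of_forall fun x => ?_)
    simp [Set.indicator]
  rw [← integrableOn_univ, ← Set.Iic_union_Ioi (a := (0 : ℝ))]
  exact hneg.union hpos

/-- `|x|^a` is integrable on `[-1, 1]` for `a > -1`. -/
lemma integrable_indicator_Iic_one_abs_rpow {a : ℝ} (ha : -1 < a) :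
    Integrable fun x : ℝ => (Set.Iic (1 : ℝ)).indicator (fun y => y ^ a) |x| := by
  refine integrable_comp_abs_of_integrableOn_Ioi ?_
  rw [integrableOn_indicator_iff measurableSet_Iic, Set.inter_comm, Set.Ioi_inter_Iic]
  exact (intervalIntegrable_iff_integrableOn_Ioc_of_le zero_le_one).mp
    (intervalIntegral.intervalIntegrable_rpow' ha)

/-- `|x|^a` is integrable away from the origin for `a < -1`. -/
lemma integrable_indicator_Ioi_abs_rpow {a c : ℝ} (ha : a < -1) (hc : 0 < c) :
    Integrable fun x : ℝ => (Set.Ioi c).indicator (fun y => y ^ a) |x| := by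
  refine integrable_comp_abs_of_integrableOn_Ioi ?_
  rw [integrableOn_indicator_iff measurableSet_Ioi]
  exact (integrableOn_Ioi_rpow_of_lt ha hc).mono_set Set.inter_subset_left

/-- A real power is Lipschitz away from the origin for exponents at most one. -/
lemma exists_abs_rpow_sub_rpow_le {p c : ℝ} (hp : p ≤ 1) (hc : 0 < c) :
    ∃ K : ℝ, 0 ≤ K ∧ ∀ x y : ℝ, c ≤ x → c ≤ y → |x ^ p - y ^ p| ≤ K * |x - y| := by
  refine ⟨|p| * c ^ (p - 1), by positivity, fun x y hx hy => ?_⟩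
  refine (convex_Ici c).norm_image_sub_le_of_norm_hasDerivWithin_le (f := fun z : ℝ => z ^ p)
    (f' := fun z => p * z ^ (p - 1)) (fun z hz => ?_) (fun z hz => ?_) hy hx
  · exact (Real.hasDerivAt_rpow_const (Or.inl (hc.trans_le hz).ne')).hasDerivWithinAt
  · have hz0 : 0 < z := hc.trans_le hz
    rw [norm_mul, Real.norm_eq_abs, Real.norm_eq_abs, abs_of_pos (Real.rpow_pos_of_pos hz0 _)]
    exact mul_le_mul_of_nonneg_left
      (Real.rpow_le_rpow_of_nonpos hc hz (by linarith)) (abs_nonneg p)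

/-- A dominating function for the rescaled integrand. -/
noncomputable def quarterMajorant (K u : ℝ) : ℝ :=
  K * (Set.Iic (1 : ℝ)).indicator (fun y => y ^ (-(1 : ℝ) / 2)) |1 - u|
    + 2 * (Set.Ioi (1 / 2 : ℝ)).indicator (fun y => y ^ (-(3 : ℝ) / 2)) |1 - u|
    + 4 * (Set.Iic (1 : ℝ)).indicator (fun y => y ^ (-(3 : ℝ) / 4)) |u|

lemma integrable_quarterMajorant (K : ℝ) : Integrable (quarterMajorant K) := by
  have h1 := (integrable_indicator_Iic_one_abs_rpow
    (a := -(1 : ℝ) / 2) (by norm_num)).comp_sub_left 1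
  have h2 := (integrable_indicator_Ioi_abs_rpow (a := -(3 : ℝ) / 2) (c := 1 / 2)
    (by norm_num) (by norm_num)).comp_sub_left 1
  have h3 := integrable_indicator_Iic_one_abs_rpow (a := -(3 : ℝ) / 4) (by norm_num)
  exact ((h1.const_mul K).add (h2.const_mul 2)).add (h3.const_mul 4)

lemma quarterMajorant_nonneg {K : ℝ} (hK : 0 ≤ K) (u : ℝ) : 0 ≤ quarterMajorant K u := by
  have h (s : Set ℝ) (a x : ℝ) : 0 ≤ s.indicator (fun y => y ^ a) |x| :=
    Set.indicator_apply_nonneg fun _ => Real.rpow_nonneg (abs_nonneg x) a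
  have h1 := mul_nonneg hK (h (Set.Iic 1) (-(1 : ℝ) / 2) (1 - u))
  have h2 := h (Set.Ioi (1 / 2)) (-(3 : ℝ) / 2) (1 - u)
  have h3 := h (Set.Iic 1) (-(3 : ℝ) / 4) u
  unfold quarterMajorant
  linarith

/-- The regularised homogeneous difference quotient is dominated uniformly in the
regularisation parameter. -/
lemma exists_abs_rpow_sub_div_le_quarterMajorant :
    ∃ K : ℝ, 0 ≤ K ∧ ∀ ε u : ℝ, 0 ≤ ε → u ≠ 0 →
      |(ε + 1) ^ (-(3 : ℝ) / 8) - (ε + u ^ 2) ^ (-(3 : ℝ) / 8)| / |1 - u| ^ ((3 : ℝ) / 2)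
        ≤ quarterMajorant K u := by
  obtain ⟨K, hK, hlip⟩ :=
    exists_abs_rpow_sub_rpow_le (p := -(3 : ℝ) / 8) (c := 1 / 4) (by norm_num) (by norm_num)
  refine ⟨K * (5 / 2), by positivity, fun ε u hε hu => ?_⟩
  have hu2 : 0 < u ^ 2 := by positivity
  have hind (s : Set ℝ) (a x : ℝ) : 0 ≤ s.indicator (fun y => y ^ a) |x| :=
    Set.indicator_apply_nonneg fun _ => Real.rpow_nonneg (abs_nonneg x) a
  have i1 := hind (Set.Iic 1) (-(1 : ℝ) / 2) (1 - u)
  have i3 := hind (Set.Iic 1) (-(3 : ℝ) / 4) u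
  rcases eq_or_ne (1 - u) 0 with h0 | h0
  · have : u = 1 := by linarith
    subst this
    simpa using quarterMajorant_nonneg (by positivity : 0 ≤ K * (5 / 2)) 1
  have hd : 0 < |1 - u| := abs_pos.mpr h0
  rcases le_or_gt |1 - u| (1 / 2) with h | h
  · obtain ⟨hl, hr⟩ := abs_le.mp h
    have hL := hlip (ε + 1) (ε + u ^ 2) (by linarith) (by nlinarith)
    have hfac : |ε + 1 - (ε + u ^ 2)| ≤ 5 / 2 * |1 - u| := by
      rw [show ε + 1 - (ε + u ^ 2) = (1 + u) * (1 - u) by ring, abs_mul]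
      gcongr
      rw [abs_le]
      constructor <;> linarith
    have hpow : |1 - u| / |1 - u| ^ ((3 : ℝ) / 2) = |1 - u| ^ (-(1 : ℝ) / 2) := by
      nth_rewrite 1 [← Real.rpow_one |1 - u|]
      rw [← Real.rpow_sub hd]
      norm_num
    have hmain : |(ε + 1) ^ (-(3 : ℝ) / 8) - (ε + u ^ 2) ^ (-(3 : ℝ) / 8)|
        / |1 - u| ^ ((3 : ℝ) / 2) ≤ K * (5 / 2) * |1 - u| ^ (-(1 : ℝ) / 2) := by
      rw [← hpow, ← mul_div_assoc]
      gcongr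
      calc _ ≤ K * |ε + 1 - (ε + u ^ 2)| := hL
        _ ≤ K * (5 / 2 * |1 - u|) := by gcongr
        _ = _ := by ring
    have i2 := hind (Set.Ioi (1 / 2)) (-(3 : ℝ) / 2) (1 - u)
    unfold quarterMajorant
    rw [Set.indicator_of_mem (show |1 - u| ∈ Set.Iic (1 : ℝ) from h.trans (by norm_num))]
    linarith
  · have ha : (ε + 1) ^ (-(3 : ℝ) / 8) ≤ 1 :=
      Real.rpow_le_one_of_one_le_of_nonpos (by linarith) (by norm_num)
    have ha0 : 0 ≤ (ε + 1) ^ (-(3 : ℝ) / 8) := by positivity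
    have hb0 : 0 ≤ (ε + u ^ 2) ^ (-(3 : ℝ) / 8) := by positivity
    have hab : |(ε + 1) ^ (-(3 : ℝ) / 8) - (ε + u ^ 2) ^ (-(3 : ℝ) / 8)|
        ≤ 1 + (ε + u ^ 2) ^ (-(3 : ℝ) / 8) := by
      rw [abs_le]
      constructor <;> linarith
    have hP : 0 ≤ |1 - u| ^ (-(3 : ℝ) / 2) := by positivity
    have hK1 := mul_nonneg (by positivity : 0 ≤ K * (5 / 2)) i1
    rw [div_eq_mul_inv, ← Real.rpow_neg hd.le, ← neg_div]
    unfold quarterMajorant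
    rw [Set.indicator_of_mem (show |1 - u| ∈ Set.Ioi (1 / 2 : ℝ) from h)]
    have hmul := mul_le_mul_of_nonneg_right hab hP
    rcases le_or_gt |u| 1 with h1 | h1
    · have hb : (ε + u ^ 2) ^ (-(3 : ℝ) / 8) ≤ |u| ^ (-(3 : ℝ) / 4) := by
        calc (ε + u ^ 2) ^ (-(3 : ℝ) / 8) ≤ (u ^ 2) ^ (-(3 : ℝ) / 8) :=
              Real.rpow_le_rpow_of_nonpos hu2 (by linarith) (by norm_num)
          _ = |u| ^ (-(3 : ℝ) / 4) := by
              rw [← sq_abs, ← Real.rpow_natCast, ← Real.rpow_mul (abs_nonneg u)]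
              norm_num
      have hQ : |1 - u| ^ (-(3 : ℝ) / 2) ≤ 4 := by
        calc |1 - u| ^ (-(3 : ℝ) / 2) ≤ (1 / 2 : ℝ) ^ (-(3 : ℝ) / 2) :=
              Real.rpow_le_rpow_of_nonpos (by norm_num) h.le (by norm_num)
          _ ≤ (1 / 2 : ℝ) ^ (-2 : ℝ) :=
              Real.rpow_le_rpow_of_exponent_ge (by norm_num) (by norm_num) (by norm_num)
          _ = 4 := by
              rw [Real.rpow_neg (by norm_num)]
              norm_num
      rw [Set.indicator_of_mem (show |u| ∈ Set.Iic (1 : ℝ) from h1)]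
      have := mul_le_mul hb hQ hP (by positivity)
      linarith
    · have hb : (ε + u ^ 2) ^ (-(3 : ℝ) / 8) ≤ 1 :=
        Real.rpow_le_one_of_one_le_of_nonpos
          (by nlinarith [sq_abs u]) (by norm_num)
      have := mul_le_mul_of_nonneg_right hb hP
      linarith

lemma vProfile_mul {t : ℝ} (ht : t ≠ 0) (u : ℝ) :
    vProfile (t * u) = |t| ^ (-(3 : ℝ) / 4) * ((t ^ 2)⁻¹ + u ^ 2) ^ (-(3 : ℝ) / 8) := by
  have hsq : |t| ^ (-(3 : ℝ) / 4) = (t ^ 2) ^ (-(3 : ℝ) / 8) := by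
    rw [← sq_abs, ← Real.rpow_natCast, ← Real.rpow_mul (abs_nonneg t)]
    norm_num
  rw [hsq, ← Real.mul_rpow (by positivity) (by positivity), vProfile]
  congr 1
  field_simp

/-- **Decay of the quarter-Laplacian of `vProfile`.** There is `C > 0` such that for
`|t| ≥ 2` the integrand of `(-Δ)^{1/4} v(t)` is integrable and
`|∫ (v(t)-v(s))/|t-s|^{3/2} ds| ≤ C |t|^{-5/4}`. -/
theorem quarterLaplacian_decay_vProfile :
    ∃ C : ℝ, 0 < C ∧ ∀ t : ℝ, 2 ≤ |t| →
      Integrable (fun s : ℝ => (vProfile t - vProfile s) / |t - s| ^ ((3 : ℝ) / 2)) ∧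
      |∫ s : ℝ, (vProfile t - vProfile s) / |t - s| ^ ((3 : ℝ) / 2)|
        ≤ C * |t| ^ (-(5 : ℝ) / 4) := by
  obtain ⟨K, hK, hmaj⟩ := exists_abs_rpow_sub_div_le_quarterMajorant
  have hI : 0 ≤ ∫ u, quarterMajorant K u := integral_nonneg (quarterMajorant_nonneg hK)
  refine ⟨(∫ u, quarterMajorant K u) + 1, by linarith, fun t ht => ?_⟩
  have hT : 0 < |t| := by linarith
  have ht0 : t ≠ 0 := abs_pos.mp hT
  set f : ℝ → ℝ := fun s => (vProfile t - vProfile s) / |t - s| ^ ((3 : ℝ) / 2) with hf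
  have hbound : ∀ᵐ u : ℝ, ‖f (t * u)‖ ≤ |t| ^ (-(9 : ℝ) / 4) * quarterMajorant K u := by
    filter_upwards [Measure.ae_ne volume (0 : ℝ)] with u hu
    have hv := vProfile_mul ht0 1
    rw [mul_one, one_pow] at hv
    have hp : |t| ^ (-(9 : ℝ) / 4) = |t| ^ (-(3 : ℝ) / 4) / |t| ^ ((3 : ℝ) / 2) := by
      rw [← Real.rpow_sub hT]
      norm_num
    have key := hmaj (t ^ 2)⁻¹ u (by positivity) hu
    calc ‖f (t * u)‖ = |t| ^ (-(9 : ℝ) / 4) *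
          (|((t ^ 2)⁻¹ + 1) ^ (-(3 : ℝ) / 8) - ((t ^ 2)⁻¹ + u ^ 2) ^ (-(3 : ℝ) / 8)|
            / |1 - u| ^ ((3 : ℝ) / 2)) := by
          simp only [hf]
          rw [hv, vProfile_mul ht0 u, ← mul_sub, show t - t * u = t * (1 - u) by ring, abs_mul,
            Real.mul_rpow (abs_nonneg _) (abs_nonneg _), norm_div, norm_mul, norm_mul,
            Real.norm_of_nonneg (by positivity : 0 ≤ |t| ^ (-(3 : ℝ) / 4)),
            Real.norm_of_nonneg (by positivity : 0 ≤ |t| ^ ((3 : ℝ) / 2)),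
            Real.norm_of_nonneg (by positivity : 0 ≤ |1 - u| ^ ((3 : ℝ) / 2)),
            Real.norm_eq_abs, hp, mul_div_mul_comm]
      _ ≤ _ := by gcongr
  have hg := (integrable_quarterMajorant K).const_mul (|t| ^ (-(9 : ℝ) / 4))
  have hmeas : Measurable f := by
    have hvm : Measurable vProfile := by
      unfold vProfile
      fun_prop
    fun_prop
  have hscaled : Integrable fun u => f (t * u) :=
    hg.mono' (hmeas.comp (measurable_const_mul t)).aestronglyMeasurable hbound
  refine ⟨(integrable_comp_mul_left_iff f ht0).mp hscaled, ?_⟩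
  have hint := norm_integral_le_of_norm_le hg hbound
  rw [Measure.integral_comp_mul_left, integral_const_mul, norm_smul, Real.norm_eq_abs,
    Real.norm_eq_abs, abs_abs, abs_inv, inv_mul_le_iff₀ hT] at hint
  have hpow : |t| * |t| ^ (-(9 : ℝ) / 4) = |t| ^ (-(5 : ℝ) / 4) := by
    nth_rewrite 1 [← Real.rpow_one |t|]
    rw [← Real.rpow_add hT]
    norm_num
  rw [← mul_assoc, hpow, mul_comm] at hint
  have hnonneg : 0 ≤ |t| ^ (-(5 : ℝ) / 4) := by positivity
  linarith
end

section
/- The functions f(u) = (1 − u^{−1/2})/(1 + u)^{3/2} and g(u) = (1 − u^{−1/2})/|1 − u|^{3/2} are Lebesgue integrable on (0,∞), and ∫₀^{∞} (1 − u^{−1/2})/(1 + u)^{3/2} du = 0 and ∫₀^{∞} (1 − u^{−1/2})/|1 − u|^{3/2} du = 0. -/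
open MeasureTheory Real

open Set in
/-- A function which changes sign under the change of variables `u ↦ u⁻¹` and is integrable on
`(0, 1)` is integrable on `(0, ∞)`, with integral zero. -/
lemma integrableOn_Ioi_and_integral_eq_zero_of_inv_antisymm {F : ℝ → ℝ}
    (hF : IntegrableOn F (Ioo 0 1)) (hinv : ∀ u, 0 < u → (u ^ 2)⁻¹ * F u⁻¹ = -F u) :
    IntegrableOn F (Ioi 0) ∧ ∫ u in Ioi (0 : ℝ), F u = 0 := by
  have hderiv : ∀ s ⊆ Ioi (0 : ℝ), ∀ u ∈ s,
      HasDerivWithinAt (fun x : ℝ => x⁻¹) (-(u ^ 2)⁻¹) s u := fun s hs u hu =>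
    (hasDerivAt_inv (ne_of_gt (hs hu))).hasDerivWithinAt
  have hinj : ∀ s : Set ℝ, InjOn (fun x : ℝ => x⁻¹) s := fun s => inv_injective.injOn
  have hsmul : ∀ u : ℝ, 0 < u → |-(u ^ 2)⁻¹| • F u⁻¹ = -F u := fun u hu => by
    rw [abs_neg, abs_of_nonneg (by positivity), smul_eq_mul, hinv u hu]
  have hsub : Ioo (0 : ℝ) 1 ⊆ Ioi 0 := fun _ hu => hu.1
  have himage : (fun x : ℝ => x⁻¹) '' Ioo 0 1 = Ioi 1 := by
    rw [image_inv_eq_inv, inv_Ioo_0_left one_pos, inv_one]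
  have himage' : (fun x : ℝ => x⁻¹) '' Ioi 0 = Ioi 0 := by
    ext x
    simp
  constructor
  · have htail : IntegrableOn F (Ioi 1) := by
      rw [← himage, integrableOn_image_iff_integrableOn_abs_deriv_smul measurableSet_Ioo
        (hderiv _ hsub) (hinj _)]
      exact hF.neg.congr_fun (fun u hu => (hsmul u hu.1).symm) measurableSet_Ioo
    rw [← Ioc_union_Ioi_eq_Ioi zero_le_one]
    exact (hF.congr_set_ae Ioo_ae_eq_Ioc.symm).union htail
  · have h := integral_image_eq_integral_abs_deriv_smul measurableSet_Ioi
      (hderiv _ subset_rfl) (hinj _) F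
    rw [himage', setIntegral_congr_fun measurableSet_Ioi (fun u hu => hsmul u hu),
      integral_neg] at h
    linarith

open Set in
lemma integrableOn_Ioo_rpow_add_one_sub_rpow :
    IntegrableOn (fun u : ℝ => u ^ (-(1 : ℝ) / 2) + (1 - u) ^ (-(1 : ℝ) / 2)) (Ioo 0 1) := by
  have h : IntervalIntegrable (fun u : ℝ => u ^ (-(1 : ℝ) / 2)) volume 0 1 :=
    intervalIntegral.intervalIntegrable_rpow' (by norm_num)
  have h' := (h.comp_sub_left 1).symm
  simp only [sub_zero, sub_self] at h'
  exact (intervalIntegrable_iff_integrableOn_Ioo_of_le zero_le_one).mp (h.add h')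

lemma abs_one_sub_rpow_div_le {u w : ℝ} (hu : 0 < u) (hu' : u < 1) (hw : 1 - u ≤ w) :
    |(1 - u ^ (-(1 : ℝ) / 2)) / w ^ ((3 : ℝ) / 2)| ≤
      u ^ (-(1 : ℝ) / 2) + (1 - u) ^ (-(1 : ℝ) / 2) := by
  have hv : 0 < 1 - u := sub_pos.mpr hu'
  have hmono : (1 - u) ^ ((3 : ℝ) / 2) ≤ w ^ ((3 : ℝ) / 2) := by gcongr
  have hpow : ∀ x : ℝ, 0 < x → x ^ (-(1 : ℝ) / 2) = (√x)⁻¹ := fun x hx => by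
    rw [neg_div, rpow_neg hx.le, sqrt_eq_rpow]
  have hcube : (1 - u) ^ ((3 : ℝ) / 2) = √(1 - u) ^ 3 := by
    rw [sqrt_eq_rpow, ← rpow_natCast, ← rpow_mul hv.le]
    norm_num
  rw [hpow u hu, hpow _ hv]
  rw [hcube] at hmono
  have ha := sqrt_pos.mpr hu
  have hb := sqrt_pos.mpr hv
  have hab : √u ^ 2 + √(1 - u) ^ 2 = 1 := by
    rw [sq_sqrt hu.le, sq_sqrt hv.le]
    ring
  generalize √u = a at *
  generalize √(1 - u) = b at *
  have ha1 : a < 1 := by nlinarith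
  have hb1 : b < 1 := by nlinarith
  have hneg : 1 - a⁻¹ ≤ 0 := sub_nonpos.mpr ((one_le_inv₀ ha).mpr ha1.le)
  have hwpos : 0 < w ^ ((3 : ℝ) / 2) := lt_of_lt_of_le (by positivity) hmono
  rw [abs_div, abs_of_nonpos hneg, abs_of_pos hwpos]
  calc -(1 - a⁻¹) / w ^ ((3 : ℝ) / 2) ≤ -(1 - a⁻¹) / b ^ 3 := by
        gcongr
        linarith
    _ ≤ a⁻¹ + b⁻¹ := by
        have e1 : -(1 - a⁻¹) / b ^ 3 = (1 - a) / (a * b ^ 3) := by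
          field_simp
          ring
        have e2 : a⁻¹ + b⁻¹ = (a + b) * b ^ 2 / (a * b ^ 3) := by
          field_simp
          ring
        rw [e1, e2]
        gcongr
        have hb2 : b ^ 2 = (1 - a) * (1 + a) := by linarith
        have hsum : 1 ≤ a + b := by nlinarith
        nlinarith [mul_le_mul_of_nonneg_right hsum (sq_nonneg b),
          mul_nonneg ha.le (sub_nonneg.mpr ha1.le)]

open Set in
/-- The cancellation for a weight `W` which satisfies `W u⁻¹ = W u / u`. -/
lemma integrableOn_and_integral_eq_zero_of_weight {W : ℝ → ℝ} (hmeas : Measurable W)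
    (hnonneg : ∀ u, 0 < u → 0 ≤ W u) (hle : ∀ u, 0 < u → u < 1 → 1 - u ≤ W u)
    (hinv : ∀ u, 0 < u → W u⁻¹ = W u / u) :
    IntegrableOn (fun u : ℝ => (1 - u ^ (-(1 : ℝ) / 2)) / W u ^ ((3 : ℝ) / 2)) (Ioi 0) ∧
    ∫ u in Ioi (0 : ℝ), (1 - u ^ (-(1 : ℝ) / 2)) / W u ^ ((3 : ℝ) / 2) = 0 := by
  refine integrableOn_Ioi_and_integral_eq_zero_of_inv_antisymm ?_ fun u hu => ?_
  · refine integrableOn_Ioo_rpow_add_one_sub_rpow.mono'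
      (Measurable.aestronglyMeasurable (by fun_prop)) ?_
    refine (ae_restrict_iff' measurableSet_Ioo).mpr (.of_forall fun u hu => ?_)
    exact abs_one_sub_rpow_div_le hu.1 hu.2 (hle u hu.1 hu.2)
  · have hroot : u ^ (-(1 : ℝ) / 2) = (√u)⁻¹ := by
      rw [neg_div, rpow_neg hu.le, sqrt_eq_rpow]
    have hcube : u ^ ((3 : ℝ) / 2) = √u ^ 3 := by
      rw [sqrt_eq_rpow, ← rpow_natCast, ← rpow_mul hu.le]
      norm_num
    have hsq : u ^ 2 = √u ^ 4 := by
      rw [show √u ^ 4 = (√u ^ 2) ^ 2 by ring, sq_sqrt hu.le]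
    rw [hinv u hu, div_rpow (hnonneg u hu) hu.le, inv_rpow hu.le, hroot, hcube, hsq, inv_inv]
    have ha := sqrt_pos.mpr hu
    generalize √u = a at *
    rw [div_div_eq_mul_div, ← mul_div_assoc, ← neg_div]
    congr 1
    field_simp
    ring

/-- **Cancellation identities.** The functions `u ↦ (1-u^{-1/2})/(1+u)^{3/2}` and
`u ↦ (1-u^{-1/2})/|1-u|^{3/2}` are integrable on `(0,∞)` and both have integral zero. -/
theorem cancellation_integrals :
    IntegrableOn (fun u : ℝ => (1 - u ^ (-(1 : ℝ) / 2)) / (1 + u) ^ ((3 : ℝ) / 2))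
        (Set.Ioi (0 : ℝ)) ∧
    IntegrableOn (fun u : ℝ => (1 - u ^ (-(1 : ℝ) / 2)) / |1 - u| ^ ((3 : ℝ) / 2))
        (Set.Ioi (0 : ℝ)) ∧
    (∫ u in Set.Ioi (0 : ℝ), (1 - u ^ (-(1 : ℝ) / 2)) / (1 + u) ^ ((3 : ℝ) / 2)) = 0 ∧
    (∫ u in Set.Ioi (0 : ℝ), (1 - u ^ (-(1 : ℝ) / 2)) / |1 - u| ^ ((3 : ℝ) / 2)) = 0 := by
  obtain ⟨hf, hf'⟩ := integrableOn_and_integral_eq_zero_of_weight (W := fun u => 1 + u)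
    (by fun_prop) (fun u hu => by positivity) (fun u hu _ => by linarith)
    (fun u hu => by field_simp; ring)
  obtain ⟨hg, hg'⟩ := integrableOn_and_integral_eq_zero_of_weight (W := fun u => |1 - u|)
    (by fun_prop) (fun u _ => abs_nonneg _) (fun u _ _ => le_abs_self _)
    (fun u hu => by
      rw [abs_sub_comm 1 u, ← abs_of_pos hu, ← abs_div, abs_of_pos hu]
      congr 1
      field_simp)
  exact ⟨hf, hg, hf', hg'⟩
end
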